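/- arXiv:1003.4592 — 3 statements merged into one kernel-verified Lean document; each statement's English description precedes it below -/
import Mathlib

section
/- Catalan's constant satisfies G = 3(1 − log 2) − ∑_{n=1}^∞ 1/(n(16n² − 1)²). -/
/-- Catalan's constant `G = ∑_{j=0}^∞ (−1)^j/(2j+1)²`. -/
noncomputable def catalan' : ℝ := ∑' j : ℕ, (-1) ^ j / (2 * (j : ℝ) + 1) ^ 2

open Filter Topology in
/-- The combination of harmonic numbers in which the Euler–Mascheroni constant cancels. -/
theorem tendsto_harmonic_add_harmonic_two_mul_sub :
    Tendsto (fun N : ℕ => (harmonic N : ℝ) + harmonic (2 * N) - 2 * harmonic (4 * N)) atTop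
      (𝓝 (-(3 * Real.log 2))) := by
  have h1 := Real.tendsto_harmonic_sub_log
  have h2 := h1.comp (tendsto_id.const_mul_atTop' (show 0 < 2 by norm_num))
  have h4 := h1.comp (tendsto_id.const_mul_atTop' (show 0 < 4 by norm_num))
  have h := ((h1.add h2).sub (h4.const_mul 2)).sub_const (3 * Real.log 2)
  have e : Real.eulerMascheroniConstant + Real.eulerMascheroniConstant
      - 2 * Real.eulerMascheroniConstant - 3 * Real.log 2 = -(3 * Real.log 2) := by ring
  rw [e] at h
  refine h.congr' ?_
  filter_upwards [eventually_gt_atTop 0] with N hN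
  have hN' : (N : ℝ) ≠ 0 := by positivity
  have l4 : Real.log 4 = 2 * Real.log 2 := by
    rw [show (4 : ℝ) = 2 ^ 2 by norm_num, Real.log_pow]
    norm_num
  simp only [Function.comp_apply, id_eq, Nat.cast_mul, Nat.cast_ofNat]
  rw [Real.log_mul two_ne_zero hN', Real.log_mul four_ne_zero hN', l4]
  ring

theorem sum_range_one_div_mul_sq_eq (N : ℕ) :
    ∑ k ∈ Finset.range N, 1 / (((k + 1 : ℕ) : ℝ) * (16 * ((k + 1 : ℕ) : ℝ) ^ 2 - 1) ^ 2) =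
      (harmonic N : ℝ) + harmonic (2 * N) - 2 * harmonic (4 * N) + 3 - 2 * (1 / ((4 * N : ℕ) + 1))
        - ∑ j ∈ Finset.range (2 * N + 1), (-1 : ℝ) ^ j / (2 * (j : ℝ) + 1) ^ 2 := by
  induction N with
  | zero => norm_num
  | succ N ih =>
    rw [Finset.sum_range_succ, ih, show 2 * (N + 1) = 2 * N + 1 + 1 by ring,
      show 4 * (N + 1) = 4 * N + 1 + 1 + 1 + 1 by ring]
    simp only [harmonic_succ, Finset.sum_range_succ _ (2 * N + 1 + 1),
      Finset.sum_range_succ _ (2 * N + 1), pow_succ (-1 : ℝ), pow_mul (-1 : ℝ)]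
    push_cast
    rw [show (16 * ((N : ℝ) + 1) ^ 2 - 1) = (4 * N + 3) * (4 * N + 5) by ring,
      show 4 * (N : ℝ) + 1 + 1 + 1 + 1 + 1 = 4 * N + 5 by ring,
      show 2 * (N : ℝ) + 1 + 1 = 2 * (N + 1) by ring,
      show 4 * (N : ℝ) + 3 + 1 = 4 * (N + 1) by ring,
      show 4 * (N : ℝ) + 2 + 1 = 4 * N + 3 by ring,
      show 4 * (N : ℝ) + 1 + 1 = 2 * (2 * N + 1) by ring,
      show 2 * (2 * (N : ℝ) + 1) + 1 = 4 * N + 3 by ring,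
      show 2 * (2 * ((N : ℝ) + 1)) + 1 = 4 * N + 5 by ring]
    norm_num
    have h1 : (N : ℝ) + 1 ≠ 0 := by positivity
    have h2 : 2 * (N : ℝ) + 1 ≠ 0 := by positivity
    have h3 : 4 * (N : ℝ) + 1 ≠ 0 := by positivity
    have h4 : 4 * (N : ℝ) + 3 ≠ 0 := by positivity
    have h5 : 4 * (N : ℝ) + 5 ≠ 0 := by positivity
    field_simp
    ring

theorem summable_neg_one_pow_div_two_mul_add_one_sq :
    Summable fun j : ℕ => (-1 : ℝ) ^ j / (2 * (j : ℝ) + 1) ^ 2 := by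
  have h : Summable fun j : ℕ => 1 / ((j + 1 : ℕ) : ℝ) ^ 2 :=
    (summable_nat_add_iff 1).2 (Real.summable_one_div_nat_pow.2 one_lt_two)
  refine Summable.of_norm_bounded h fun j => ?_
  rw [norm_div, norm_pow, norm_neg, norm_one, one_pow, Real.norm_of_nonneg (by positivity)]
  push_cast
  gcongr
  linarith [(Nat.cast_nonneg j : (0 : ℝ) ≤ j)]

open Filter Topology in
theorem catalan_eq_three_sub_log_two_sub_sum :
    catalan' = 3 * (1 - Real.log 2) -
      ∑' n : ℕ+, 1 / ((n : ℝ) * (16 * (n : ℝ) ^ 2 - 1) ^ 2) := by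
  have hG := summable_neg_one_pow_div_two_mul_add_one_sq.hasSum.tendsto_sum_nat.comp
    (tendsto_atTop_mono (fun N : ℕ => (by omega : N ≤ 2 * N + 1)) tendsto_id)
  have h0 := (tendsto_one_div_add_atTop_nhds_zero_nat (𝕜 := ℝ)).comp
    (tendsto_id.const_mul_atTop' (show 0 < 4 by norm_num))
  have h := ((tendsto_harmonic_add_harmonic_two_mul_sub.add_const 3).sub (h0.const_mul 2)).sub hG
  have hs := (hasSum_iff_tendsto_nat_of_nonneg (fun k : ℕ => by positivity) _).2
    (h.congr fun N => (sum_range_one_div_mul_sq_eq N).symm)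
  rw [tsum_pnat_eq_tsum_succ (f := fun n : ℕ => 1 / ((n : ℝ) * (16 * (n : ℝ) ^ 2 - 1) ^ 2)),
    hs.tsum_eq, catalan']
  ring
end

section
/- For every real number p with 0 < |p| < 2, ψ''(1 + p/2) + ψ''(1 − p/2) = −64p⁴ ∑_{n=1}^∞ 1/(n(4n² − p²)³) − 80p² ∑_{n=1}^∞ 1/(n(4n² − p²)²) − 16 ∑_{n=1}^∞ 1/(n(4n² − p²)), where ψ'' is the second derivative of the digamma function. -/
/-- The digamma function `ψ(x) = Γ'(x)/Γ(x)`. -/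
noncomputable def digamma (x : ℝ) : ℝ := deriv Real.Gamma x / Real.Gamma x

open Filter Topology Set

theorem digamma_add_one {x : ℝ} (hx : 0 < x) : digamma (x + 1) = digamma x + x⁻¹ := by
  have hd : DifferentiableAt ℝ Real.Gamma x :=
    Real.differentiableAt_Gamma fun m => by have := m.cast_nonneg (α := ℝ); linarith
  have h : deriv (fun y => Real.Gamma (y + 1)) x = deriv (fun y => y * Real.Gamma y) x := by
    apply Filter.EventuallyEq.deriv_eq
    filter_upwards [eventually_ne_nhds hx.ne'] with y hy using Real.Gamma_add_one hy
  have h' : deriv (fun y => y * Real.Gamma y) x = Real.Gamma x + x * deriv Real.Gamma x := by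
    simpa using ((hasDerivAt_id' x).fun_mul hd.hasDerivAt).deriv
  rw [deriv_comp_add_const, h'] at h
  have hG := (Real.Gamma_pos_of_pos hx).ne'
  rw [digamma, digamma, h, Real.Gamma_add_one hx.ne']
  field_simp
  ring

theorem monotoneOn_digamma : MonotoneOn digamma (Ioi 0) := by
  have hd : ∀ x ∈ Ioi (0 : ℝ), DifferentiableAt ℝ Real.Gamma x := fun x (hx : 0 < x) =>
    Real.differentiableAt_Gamma fun m => by have := m.cast_nonneg (α := ℝ); linarith
  have hne : ∀ x ∈ Ioi (0 : ℝ), Real.Gamma x ≠ 0 := fun x hx => (Real.Gamma_pos_of_pos hx).ne'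
  refine (Real.convexOn_log_Gamma.monotoneOn_deriv fun x hx => (hd x hx).log (hne x hx)).congr
    fun x hx => ?_
  exact ((hd x hx).hasDerivAt.log (hne x hx)).deriv

theorem digamma_add_nat {x : ℝ} (hx : 0 < x) (N : ℕ) :
    digamma (x + N) = digamma x + ∑ k ∈ Finset.range N, (x + k)⁻¹ := by
  induction N with
  | zero => simp
  | succ N ih =>
    rw [Finset.sum_range_succ, ← add_assoc, ← ih, ← digamma_add_one (by positivity)]
    push_cast
    ring_nf

theorem tendsto_digamma_natCast_add_sub (m : ℕ) :
    Tendsto (fun N : ℕ => digamma (N + m) - digamma N) atTop (𝓝 0) := by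
  have h : Tendsto (fun N : ℕ => ∑ k ∈ Finset.range m, ((N : ℝ) + k)⁻¹) atTop (𝓝 0) := by
    rw [← Finset.sum_const_zero (s := Finset.range m)]
    exact tendsto_finsetSum _ fun k _ => tendsto_inv_atTop_zero.comp
      (tendsto_atTop_add_const_right _ _ tendsto_natCast_atTop_atTop)
  refine h.congr' ?_
  filter_upwards [eventually_gt_atTop 0] with N hN
  rw [digamma_add_nat (by exact_mod_cast hN), add_sub_cancel_left]

theorem tendsto_digamma_add_natCast_sub {x : ℝ} (hx : 0 < x) :
    Tendsto (fun N : ℕ => digamma (x + N) - digamma N) atTop (𝓝 0) := by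
  refine tendsto_of_tendsto_of_tendsto_of_le_of_le' tendsto_const_nhds
    (tendsto_digamma_natCast_add_sub ⌈x⌉₊) ?_ ?_ <;>
  filter_upwards [eventually_gt_atTop 0] with N hN
  all_goals have hN' : (0 : ℝ) < N := by exact_mod_cast hN
  · exact sub_nonneg.2 (monotoneOn_digamma hN' (add_pos hx hN') (by linarith))
  · have := Nat.le_ceil x
    exact sub_le_sub_right (monotoneOn_digamma (add_pos hx hN')
      (add_pos_of_pos_of_nonneg hN' (Nat.cast_nonneg _)) (by linarith)) _

theorem summable_inv_add_natCast_pow {a : ℝ} (ha : 0 < a) {r : ℕ} (hr : 1 < r) :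
    Summable fun k : ℕ => ((a + k) ^ r)⁻¹ := by
  refine ((Real.summable_one_div_nat_add_rpow a r).2 (by exact_mod_cast hr)).congr fun k => ?_
  rw [Real.rpow_natCast, abs_of_pos (by positivity), one_div, add_comm]

theorem hasDerivAt_inv_add_pow {y k : ℝ} (h : 0 < y + k) (r : ℕ) :
    HasDerivAt (fun z => ((z + k) ^ r)⁻¹) (-r * ((y + k) ^ (r + 1))⁻¹) y := by
  have h' := (((hasDerivAt_id' y).add_const k).fun_pow r).fun_inv (pow_pos h r).ne'
  refine h'.congr_deriv ?_
  rcases r with _ | r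
  · simp
  · rw [Nat.add_sub_cancel]
    field_simp
    ring

theorem hasDerivAt_digamma {x : ℝ} (hx : 0 < x) :
    HasDerivAt digamma (∑' k : ℕ, ((x + k) ^ 2)⁻¹) x := by
  set g : ℕ → ℝ → ℝ := fun k y => (1 + (k : ℝ))⁻¹ - (y + k)⁻¹
  have key : ∀ a : ℝ, 0 < a → a < 1 → ∀ y, a < y →
      Summable (g · y) ∧ HasDerivAt (fun z => ∑' k, g k z) (∑' k : ℕ, ((y + k) ^ 2)⁻¹) y := by
    intro a ha ha1 y hy
    have hder : ∀ (k : ℕ) (z : ℝ), z ∈ Ioi a → HasDerivAt (g k) (((z + k) ^ 2)⁻¹) z := by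
      intro k z hz
      have hz' : 0 < z + k := add_pos_of_pos_of_nonneg (ha.trans hz) (Nat.cast_nonneg k)
      simpa [g] using (hasDerivAt_inv_add_pow hz' 1).const_sub (1 + (k : ℝ))⁻¹
    have hbd : ∀ (k : ℕ) (z : ℝ), z ∈ Ioi a → ‖((z + k) ^ 2)⁻¹‖ ≤ ((a + k) ^ 2)⁻¹ := by
      intro k z hz
      rw [Real.norm_of_nonneg (by positivity)]
      have : a ≤ z := le_of_lt hz
      gcongr
    have h0 : Summable (g · 1) := by simp [g]
    have hs := summable_inv_add_natCast_pow ha one_lt_two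
    exact ⟨summable_of_summable_hasDerivAt_of_isPreconnected hs isOpen_Ioi isPreconnected_Ioi
        hder hbd ha1 h0 hy,
      hasDerivAt_tsum_of_isPreconnected hs isOpen_Ioi isPreconnected_Ioi hder hbd ha1 h0 hy⟩
  have key' : ∀ y, 0 < y →
      Summable (g · y) ∧ HasDerivAt (fun z => ∑' k, g k z) (∑' k : ℕ, ((y + k) ^ 2)⁻¹) y := by
    intro y hy
    obtain ⟨a, ha, ha'⟩ := exists_between (lt_min one_pos hy)
    exact key a ha (ha'.trans_le (min_le_left _ _)) y (ha'.trans_le (min_le_right _ _))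
  have hval : ∀ y, 0 < y → digamma y = digamma 1 + ∑' k, g k y := by
    intro y hy
    have h1 := (tendsto_digamma_add_natCast_sub hy).sub (tendsto_digamma_add_natCast_sub one_pos)
    have h2 : Tendsto (fun N : ℕ => digamma y - digamma 1 - ∑ k ∈ Finset.range N, g k y) atTop
        (𝓝 (0 - 0)) := by
      refine h1.congr fun N => ?_
      rw [digamma_add_nat hy, digamma_add_nat one_pos]
      simp only [g, Finset.sum_sub_distrib]
      ring
    have h3 := (key' y hy).1.hasSum.tendsto_sum_nat.const_sub (digamma y - digamma 1)
    have := tendsto_nhds_unique h2 h3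
    linarith
  refine ((key' x hx).2.const_add (digamma 1)).congr_of_eventuallyEq ?_
  filter_upwards [Ioi_mem_nhds hx] with y hy using hval y hy

theorem iteratedDeriv_two_digamma {x : ℝ} (hx : 0 < x) :
    iteratedDeriv 2 digamma x = ∑' k : ℕ, -2 * ((x + k) ^ 3)⁻¹ := by
  have h1 : deriv digamma =ᶠ[𝓝 x] fun y => ∑' k : ℕ, ((y + k) ^ 2)⁻¹ := by
    filter_upwards [Ioi_mem_nhds hx] with y hy using (hasDerivAt_digamma hy).deriv
  rw [iteratedDeriv_succ, iteratedDeriv_one, h1.deriv_eq]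
  have ha : 0 < x / 2 := half_pos hx
  have hxa : x ∈ Ioi (x / 2) := half_lt_self hx
  have hg : ∀ (k : ℕ) (z : ℝ), z ∈ Ioi (x / 2) →
      HasDerivAt (fun w : ℝ => ((w + k) ^ 2)⁻¹) (-2 * ((z + k) ^ 3)⁻¹) z := by
    intro k z hz
    simpa using hasDerivAt_inv_add_pow
      (add_pos_of_pos_of_nonneg (ha.trans hz) (Nat.cast_nonneg k)) 2
  have hbd : ∀ (k : ℕ) (z : ℝ), z ∈ Ioi (x / 2) →
      ‖-2 * ((z + k) ^ 3)⁻¹‖ ≤ 2 * ((x / 2 + k) ^ 3)⁻¹ := by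
    intro k z hz
    have hz' : x / 2 ≤ z := le_of_lt hz
    have hz0 : 0 < z := ha.trans hz
    rw [norm_mul, Real.norm_of_nonneg (r := (_)⁻¹) (by positivity), norm_neg, Real.norm_ofNat]
    gcongr
  exact (hasDerivAt_tsum_of_isPreconnected
    ((summable_inv_add_natCast_pow ha (r := 3) (by norm_num)).mul_left 2) isOpen_Ioi
    isPreconnected_Ioi hg hbd hxa (summable_inv_add_natCast_pow hx one_lt_two) hxa).deriv

theorem four_sub_sq_mul_le {p : ℝ} (n : ℕ+) :
    (4 - p ^ 2) * (n : ℝ) ^ 2 ≤ 4 * (n : ℝ) ^ 2 - p ^ 2 := by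
  have hn : (1 : ℝ) ≤ n := by exact_mod_cast one_le (a := n)
  nlinarith [mul_nonneg (sq_nonneg p) (sub_nonneg.2 (one_le_pow₀ hn (n := 2)))]

theorem summable_one_div_mul_four_mul_sq_sub_pow {p : ℝ} (hp : |p| < 2) {r : ℕ} (hr : r ≠ 0) :
    Summable fun n : ℕ+ => 1 / ((n : ℝ) * (4 * (n : ℝ) ^ 2 - p ^ 2) ^ r) := by
  have hc : 0 < 4 - p ^ 2 := by nlinarith [abs_nonneg p, sq_abs p]
  have hs : Summable fun n : ℕ+ => ((4 - p ^ 2) ^ r)⁻¹ * (((n : ℕ) : ℝ) ^ 2)⁻¹ :=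
    ((Real.summable_nat_pow_inv.2 one_lt_two).comp_injective PNat.coe_injective).mul_left _
  refine hs.of_nonneg_of_le (fun n => ?_) fun n => ?_
  all_goals
    have hn : (1 : ℝ) ≤ n := by exact_mod_cast one_le (a := n)
    have hD := four_sub_sq_mul_le (p := p) n
    have hcn : 0 < (4 - p ^ 2) * (n : ℝ) ^ 2 := by positivity
  · have := hcn.trans_le hD
    positivity
  · rw [one_div, ← mul_inv]
    refine inv_anti₀ (by positivity) ?_
    calc (4 - p ^ 2) ^ r * (n : ℝ) ^ 2 ≤ (4 - p ^ 2) ^ r * ((n : ℝ) ^ 2) ^ r := by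
          gcongr
          exact le_self_pow₀ (one_le_pow₀ hn) hr
      _ = 1 * ((4 - p ^ 2) * (n : ℝ) ^ 2) ^ r := by rw [mul_pow, one_mul]
      _ ≤ n * (4 * (n : ℝ) ^ 2 - p ^ 2) ^ r := by gcongr

theorem hasSum_iteratedDeriv_two_digamma_one_add {x : ℝ} (hx : -1 < x) :
    HasSum (fun n : ℕ+ => -2 * (((n : ℝ) + x) ^ 3)⁻¹) (iteratedDeriv 2 digamma (1 + x)) := by
  have hx' : 0 < 1 + x := by linarith
  have hs := ((summable_inv_add_natCast_pow hx' (r := 3) (by norm_num)).mul_left (-2)).hasSum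
  rw [← iteratedDeriv_two_digamma hx'] at hs
  rw [hasSum_pnat_iff_hasSum_succ (f := fun n : ℕ => -2 * (((n : ℝ) + x) ^ 3)⁻¹)]
  refine hs.congr_fun fun n => ?_
  push_cast
  ring_nf

theorem tetragamma_identity (p : ℝ) (hp : 0 < |p|) (hp' : |p| < 2) :
    iteratedDeriv 2 digamma (1 + p / 2) + iteratedDeriv 2 digamma (1 - p / 2) =
      -64 * p ^ 4 * (∑' n : ℕ+, 1 / ((n : ℝ) * (4 * (n : ℝ) ^ 2 - p ^ 2) ^ 3)) -
        80 * p ^ 2 * (∑' n : ℕ+, 1 / ((n : ℝ) * (4 * (n : ℝ) ^ 2 - p ^ 2) ^ 2)) -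
        16 * ∑' n : ℕ+, 1 / ((n : ℝ) * (4 * (n : ℝ) ^ 2 - p ^ 2)) := by
  obtain ⟨hp1, hp2⟩ := abs_lt.1 hp'
  have hadd := hasSum_iteratedDeriv_two_digamma_one_add (x := p / 2) (by linarith)
  have hsub := hasSum_iteratedDeriv_two_digamma_one_add (x := -(p / 2)) (by linarith)
  have h1 := summable_one_div_mul_four_mul_sq_sub_pow hp' one_ne_zero
  have h2 := summable_one_div_mul_four_mul_sq_sub_pow hp' two_ne_zero
  have h3 := summable_one_div_mul_four_mul_sq_sub_pow hp' three_ne_zero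
  simp only [pow_one] at h1
  rw [sub_eq_add_neg 1 (p / 2)]
  refine (hadd.add hsub).unique ?_
  refine (((h3.hasSum.mul_left (-64 * p ^ 4)).sub (h2.hasSum.mul_left (80 * p ^ 2))).sub
    (h1.hasSum.mul_left 16)).congr_fun fun n => ?_
  have hn : (1 : ℝ) ≤ n := by exact_mod_cast one_le (a := n)
  have hn0 : (n : ℝ) ≠ 0 := by linarith
  have ha : 2 * (n : ℝ) + p ≠ 0 := by linarith
  have hb : 2 * (n : ℝ) - p ≠ 0 := by linarith
  rw [show (n : ℝ) + p / 2 = (2 * n + p) / 2 by ring,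
    show (n : ℝ) + -(p / 2) = (2 * n - p) / 2 by ring,
    show 4 * (n : ℝ) ^ 2 - p ^ 2 = (2 * n + p) * (2 * n - p) by ring]
  field_simp
  ring
end

section
/- 16 ∑_{n=1}^∞ 1/(n(16n² − 1)³) = 7ζ(3) + 48 log 2 + 20G − 60, where ζ(3) = ∑_{n=1}^∞ 1/n³ and G is Catalan's constant. -/
open Filter Topology Finset in
/-- The partial sums of the series in terms of harmonic-type sums, by partial fractions. -/
theorem sum_range_eq_harmonic_sums (N : ℕ) :
    16 * ∑ n ∈ range N, 1 / (((n : ℝ) + 1) * (16 * ((n : ℝ) + 1) ^ 2 - 1) ^ 3) =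
      32 * (∑ i ∈ range (4 * N + 1), 1 / ((i : ℝ) + 1)
        - (∑ i ∈ range (2 * N), 1 / ((i : ℝ) + 1)) / 2
        - (∑ i ∈ range N, 1 / ((i : ℝ) + 1)) / 2 - 1)
      - 20 * (1 - ∑ j ∈ range (2 * N + 1), (-1) ^ j / (2 * (j : ℝ) + 1) ^ 2)
      + 8 * (∑ i ∈ range (4 * N + 1), 1 / ((i : ℝ) + 1) ^ 3
        - (∑ i ∈ range (2 * N), 1 / ((i : ℝ) + 1) ^ 3) / 8 - 1) := by
  induction N with
  | zero => norm_num
  | succ N ih =>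
    have key : 16 * (1 / (((N : ℝ) + 1) * (16 * ((N : ℝ) + 1) ^ 2 - 1) ^ 3)) =
        32 * (1 / (4 * (N : ℝ) + 3) + 1 / (4 * (N : ℝ) + 5) - 1 / (2 * ((N : ℝ) + 1)))
        - 20 * (1 / (4 * (N : ℝ) + 3) ^ 2 - 1 / (4 * (N : ℝ) + 5) ^ 2)
        + 8 * (1 / (4 * (N : ℝ) + 3) ^ 3 + 1 / (4 * (N : ℝ) + 5) ^ 3) := by
      have h : 16 * ((N : ℝ) + 1) ^ 2 - 1 = (4 * N + 3) * (4 * N + 5) := by ring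
      rw [h]
      field_simp
      ring
    rw [sum_range_succ, mul_add, ih, key,
      show 4 * (N + 1) + 1 = 4 * N + 1 + 1 + 1 + 1 + 1 by ring,
      show 2 * (N + 1) = 2 * N + 1 + 1 by ring]
    simp only [sum_range_succ _ (4 * N + 1 + 1 + 1 + 1), sum_range_succ _ (4 * N + 1 + 1 + 1),
      sum_range_succ _ (4 * N + 1 + 1), sum_range_succ _ (4 * N + 1),
      sum_range_succ _ (2 * N + 1 + 1), sum_range_succ _ (2 * N + 1), sum_range_succ _ (2 * N),
      sum_range_succ _ N]
    have e0 : (-1 : ℝ) ^ (2 * N) = 1 := by simp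
    simp only [pow_succ (-1 : ℝ), e0]
    push_cast
    have e1 : 4 * (N : ℝ) + 1 + 1 = 2 * (2 * N + 1) := by ring
    have e2 : 4 * (N : ℝ) + 1 + 1 + 1 = 4 * N + 3 := by ring
    have e3 : 4 * (N : ℝ) + 1 + 1 + 1 + 1 = 4 * (N + 1) := by ring
    have e4 : 4 * (N : ℝ) + 1 + 1 + 1 + 1 + 1 = 4 * N + 5 := by ring
    have e5 : 2 * (N : ℝ) + 1 + 1 = 2 * (N + 1) := by ring
    have e6 : 2 * (2 * (N : ℝ) + 1) + 1 = 4 * N + 3 := by ring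
    have e7 : 2 * (2 * ((N : ℝ) + 1)) + 1 = 4 * N + 5 := by ring
    rw [e4, e3, e2, e1, e5, e6, e7]
    simp only [mul_pow, one_div, mul_inv]
    ring

open Filter Topology Finset in
theorem tendsto_harmonic_combination :
    Tendsto (fun N : ℕ ↦ ∑ i ∈ range (4 * N + 1), 1 / ((i : ℝ) + 1)
      - (∑ i ∈ range (2 * N), 1 / ((i : ℝ) + 1)) / 2
      - (∑ i ∈ range N, 1 / ((i : ℝ) + 1)) / 2) atTop (𝓝 (3 / 2 * Real.log 2)) := by
  have hγ : Tendsto (fun N : ℕ ↦ ∑ i ∈ range N, 1 / ((i : ℝ) + 1) - Real.log N) atTop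
      (𝓝 Real.eulerMascheroniConstant) := by
    refine Real.tendsto_harmonic_sub_log.congr fun N ↦ ?_
    simp [harmonic]
  have h2 : Tendsto (fun N : ℕ ↦ 2 * N) atTop atTop :=
    tendsto_id.const_mul_atTop' (by norm_num)
  have h4 : Tendsto (fun N : ℕ ↦ 4 * N) atTop atTop :=
    tendsto_id.const_mul_atTop' (by norm_num)
  have hz : Tendsto (fun N : ℕ ↦ 1 / (((4 * N : ℕ) : ℝ) + 1)) atTop (𝓝 0) :=
    (tendsto_one_div_add_atTop_nhds_zero_nat (𝕜 := ℝ)).comp h4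
  have key := ((((hγ.comp h4).add hz).sub ((hγ.comp h2).div_const 2)).sub
    (hγ.div_const 2)).add_const (3 / 2 * Real.log 2)
  rw [show Real.eulerMascheroniConstant + 0 - Real.eulerMascheroniConstant / 2
    - Real.eulerMascheroniConstant / 2 + 3 / 2 * Real.log 2 = 3 / 2 * Real.log 2 by ring] at key
  refine key.congr' ?_
  filter_upwards [eventually_gt_atTop 0] with N hN
  have hN' : (N : ℝ) ≠ 0 := by positivity
  have l4 : Real.log (4 * N) = 2 * Real.log 2 + Real.log N := by
    rw [Real.log_mul (by norm_num) hN', show (4 : ℝ) = 2 ^ 2 by norm_num, Real.log_pow]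
    norm_num
  simp only [Function.comp_apply, sum_range_succ]
  push_cast
  rw [l4, Real.log_mul (by norm_num) hN']
  ring

theorem summable_one_div_succ_cube : Summable fun n : ℕ ↦ 1 / ((n : ℝ) + 1) ^ 3 := by
  simpa using (summable_nat_add_iff 1).2 (Real.summable_one_div_nat_pow.2 (by norm_num : 1 < 3))

theorem summable_catalan :
    Summable fun j : ℕ ↦ (-1 : ℝ) ^ j / (2 * (j : ℝ) + 1) ^ 2 := by
  have h : Summable fun n : ℕ ↦ 1 / ((n : ℝ) + 1) ^ 2 := by
    simpa using (summable_nat_add_iff 1).2 (Real.summable_one_div_nat_pow.2 (by norm_num : 1 < 2))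
  refine h.of_norm_bounded fun j ↦ ?_
  rw [norm_div, norm_pow, norm_neg, norm_one, one_pow, Real.norm_of_nonneg (by positivity)]
  gcongr
  linarith [(Nat.cast_nonneg j : (0 : ℝ) ≤ j)]

theorem summable_one_div_mul_cube :
    Summable fun n : ℕ ↦ 1 / (((n : ℝ) + 1) * (16 * ((n : ℝ) + 1) ^ 2 - 1) ^ 3) := by
  have hle (n : ℕ) : (n : ℝ) + 1 ≤ 16 * ((n : ℝ) + 1) ^ 2 - 1 := by nlinarith [sq_nonneg (n : ℝ)]
  have hpos (n : ℕ) : 0 < 16 * ((n : ℝ) + 1) ^ 2 - 1 := lt_of_lt_of_le (by positivity) (hle n)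
  refine summable_one_div_succ_cube.of_nonneg_of_le (fun n ↦ ?_) fun n ↦ ?_
  · have := hpos n
    positivity
  · refine one_div_le_one_div_of_le (by positivity) ?_
    calc ((n : ℝ) + 1) ^ 3 ≤ (16 * ((n : ℝ) + 1) ^ 2 - 1) ^ 3 := by gcongr; exact hle n
      _ ≤ _ := le_mul_of_one_le_left (pow_nonneg (hpos n).le 3) (by simp)

open Filter Topology in
theorem sixteen_mul_sum_eq_apery_combination :
    16 * ∑' n : ℕ+, 1 / ((n : ℝ) * (16 * (n : ℝ) ^ 2 - 1) ^ 3) =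
      7 * (∑' n : ℕ+, 1 / (n : ℝ) ^ 3) + 48 * Real.log 2 + 20 * catalan' - 60 := by
  rw [tsum_pnat_eq_tsum_succ (f := fun n : ℕ ↦ 1 / ((n : ℝ) * (16 * (n : ℝ) ^ 2 - 1) ^ 3)),
    tsum_pnat_eq_tsum_succ (f := fun n : ℕ ↦ 1 / (n : ℝ) ^ 3)]
  unfold catalan'
  push_cast
  have h2 : Tendsto (fun N : ℕ ↦ 2 * N) atTop atTop :=
    tendsto_id.const_mul_atTop' (by norm_num)
  have h4 : Tendsto (fun N : ℕ ↦ 4 * N) atTop atTop :=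
    tendsto_id.const_mul_atTop' (by norm_num)
  have hs := tendsto_add_atTop_nat 1
  have hζ := summable_one_div_succ_cube.hasSum.tendsto_sum_nat
  have hG := summable_catalan.hasSum.tendsto_sum_nat
  have hL := summable_one_div_mul_cube.hasSum.tendsto_sum_nat.const_mul 16
  have hR := (((tendsto_harmonic_combination.sub_const 1).const_mul 32).sub
    (((hG.comp (hs.comp h2)).const_sub 1).const_mul 20)).add
    ((((hζ.comp (hs.comp h4)).sub ((hζ.comp h2).div_const 8)).sub_const 1).const_mul 8)
  rw [tendsto_nhds_unique hL (hR.congr fun N ↦ (sum_range_eq_harmonic_sums N).symm)]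
  ring
end
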